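/- Let H = ℓ² with standard orthonormal basis (e_n)_{n≥1}, and for φ ∈ L¹(𝕋) (integrable functions on the circle with norm ∫₀^{2π}|φ(t)| dt/2π) let φ̂(n) = ∫₀^{2π} φ(t) e^{−int} dt/2π. Define S(φ) ∈ B(ℓ²) as the diagonal operator S(φ)(x) = (φ̂(n) x_n)_{n≥1} for x = (x_n) ∈ ℓ². Then S : L¹(𝕋) → B(ℓ²) is a well-defined bounded linear operator with operator norm exactly 1; S(φ_k) is the rank-one projection z ↦ ⟨z,e_k⟩e_k for k ≥ 1 and S(φ_k) = 0 for k ≤ 0, where φ_k(t) = e^{ikt}; and there is no Bochner-integrable function f ∈ L¹(𝕋, B(ℓ²)) such that S(φ) = ∫₀^{2π} φ(t) f(t) dt/2π for every continuous φ on 𝕋. -/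

import Mathlib

open scoped ENNReal NNReal
open MeasureTheory Complex AddCircle

noncomputable section

instance : Fact (0 < 2 * Real.pi) := ⟨by positivity⟩

/-- `ℓ²`: square-summable complex sequences. -/
abbrev ellTwoC : Type := lp (fun _ : ℕ => ℂ) 2

/-- `L¹(𝕋)` with respect to the normalized Haar (Lebesgue) measure `dt/2π` on the circle. -/
abbrev L1Circle : Type :=
  Lp ℂ 1 (haarAddCircle : Measure (AddCircle (2 * Real.pi)))

/-- `S` is the "diagonal multiplication by Fourier coefficients" operator: for `φ ∈ L¹(𝕋)`,
`S(φ)` is the diagonal operator on `ℓ²` with diagonal entries `φ̂(n)`, `n ≥ 1` (the coordinate of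
index `n : ℕ` representing the `(n+1)`-st entry). -/
def IsFourierDiagonal (S : L1Circle →L[ℂ] (ellTwoC →L[ℂ] ellTwoC)) : Prop :=
  ∀ (φ : L1Circle) (x : ellTwoC) (n : ℕ),
    (S φ x) n = fourierCoeff (φ : AddCircle (2 * Real.pi) → ℂ) ((n : ℤ) + 1) * x n

lemma fd_coeff_norm_le (φ : L1Circle) (n : ℤ) :
    ‖fourierCoeff (φ : AddCircle (2 * Real.pi) → ℂ) n‖ ≤ ‖φ‖ := by
  rw [fourierCoeff, L1.norm_eq_integral_norm]
  refine (norm_integral_le_integral_norm _).trans (le_of_eq ?_)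
  congr 1
  ext t
  rw [norm_smul, fourier_apply, Circle.norm_coe, one_mul]

lemma fd_memlp (φ : L1Circle) (x : ellTwoC) :
    Memℓp (fun n : ℕ => fourierCoeff (φ : AddCircle (2 * Real.pi) → ℂ) ((n : ℤ) + 1) * x n) 2 := by
  refine Memℓp.mono' (lp.memℓp ((‖φ‖ : ℂ) • x)) (fun n => ?_)
  simp only [lp.coeFn_smul, Pi.smul_apply, norm_smul, norm_mul, Complex.norm_real, norm_norm]
  exact mul_le_mul_of_nonneg_right (fd_coeff_norm_le φ _) (norm_nonneg _)

lemma fd_norm_le {S : L1Circle →L[ℂ] (ellTwoC →L[ℂ] ellTwoC)} (hS : IsFourierDiagonal S) :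
    ‖S‖ ≤ 1 := by
  refine ContinuousLinearMap.opNorm_le_bound _ zero_le_one fun φ => ?_
  rw [one_mul]
  refine ContinuousLinearMap.opNorm_le_bound _ (norm_nonneg _) fun x => ?_
  have h : ‖S φ x‖ ≤ ‖(‖φ‖ : ℂ) • x‖ := by
    refine lp.norm_mono (by norm_num) (fun n => ?_)
    rw [hS]
    simp only [lp.coeFn_smul, Pi.smul_apply, norm_smul, norm_mul, Complex.norm_real, norm_norm]
    exact mul_le_mul_of_nonneg_right (fd_coeff_norm_le φ _) (norm_nonneg _)
  rwa [norm_smul, Complex.norm_real, norm_norm] at h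

lemma fd_exists : ∃ S : L1Circle →L[ℂ] (ellTwoC →L[ℂ] ellTwoC), IsFourierDiagonal S := by
  refine ⟨LinearMap.mkContinuous₂ (LinearMap.mk₂ ℂ
    (fun (φ : L1Circle) (x : ellTwoC) => (⟨_, fd_memlp φ x⟩ : ellTwoC)) ?_ ?_ ?_ ?_) 1 ?_, ?_⟩
  · intro φ ψ x
    ext n
    change fourierCoeff _ _ * x n = fourierCoeff _ _ * x n + fourierCoeff _ _ * x n
    rw [fourierCoeff_congr_ae (Lp.coeFn_add φ ψ),
      fourierCoeff.add (L1.integrable_coeFn φ) (L1.integrable_coeFn ψ), Pi.add_apply, add_mul]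
  · intro c φ x
    ext n
    change fourierCoeff _ _ * x n = c * (fourierCoeff _ _ * x n)
    rw [fourierCoeff_congr_ae (Lp.coeFn_smul c φ), fourierCoeff.const_smul, smul_eq_mul, mul_assoc]
  · intro φ x y
    ext n
    exact mul_add _ _ _
  · intro c φ x
    ext n
    exact mul_left_comm _ _ _
  · intro φ x
    have h : ‖(⟨_, fd_memlp φ x⟩ : ellTwoC)‖ ≤ ‖(‖φ‖ : ℂ) • x‖ := by
      refine lp.norm_mono (by norm_num) (fun n => ?_)
      simp only [lp.coeFn_smul, Pi.smul_apply, norm_smul, norm_mul, Complex.norm_real, norm_norm]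
      exact mul_le_mul_of_nonneg_right (fd_coeff_norm_le φ _) (norm_nonneg _)
    rw [norm_smul, Complex.norm_real, norm_norm] at h
    rw [one_mul]
    exact h
  · intro φ x n
    rfl

lemma fd_coeff_fourierLp (k m : ℤ) :
    fourierCoeff ((fourierLp 1 k : L1Circle) : AddCircle (2 * Real.pi) → ℂ) m =
      if m = k then 1 else 0 := by
  rw [fourierCoeff_congr_ae (coeFn_fourierLp 1 k), fourierCoeff_fourier, Pi.single_apply]

lemma fd_norm_fourierLp_le (k : ℤ) : ‖(fourierLp 1 k : L1Circle)‖ ≤ 1 := by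
  rw [L1.norm_eq_integral_norm]
  have : ∫ t, ‖(fourierLp 1 k : L1Circle) t‖ ∂haarAddCircle =
      ∫ t : AddCircle (2 * Real.pi), (1 : ℝ) ∂haarAddCircle := by
    refine integral_congr_ae ?_
    filter_upwards [coeFn_fourierLp 1 k] with t ht
    rw [ht, fourier_apply, Circle.norm_coe]
  rw [this]
  simp

lemma fd_apply {S : L1Circle →L[ℂ] (ellTwoC →L[ℂ] ellTwoC)} (hS : IsFourierDiagonal S)
    (k : ℕ) (x : ellTwoC) (n : ℕ) :
    (S (fourierLp 1 ((k : ℤ) + 1)) x) n = if n = k then x k else 0 := by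
  rw [hS, fd_coeff_fourierLp]
  by_cases h : n = k
  · simp [h]
  · simp [h]

lemma fd_one_le {S : L1Circle →L[ℂ] (ellTwoC →L[ℂ] ellTwoC)} (hS : IsFourierDiagonal S)
    (k : ℕ) : 1 ≤ ‖S (fourierLp 1 ((k : ℤ) + 1))‖ := by
  set x : ellTwoC := lp.single 2 k 1 with hx
  have hxn : ‖x‖ = 1 := by
    rw [hx, lp.norm_single (by norm_num)]; simp
  have h1 := (S (fourierLp 1 ((k : ℤ) + 1))).le_opNorm x
  have h2 := lp.norm_apply_le_norm (by norm_num) (S (fourierLp 1 ((k : ℤ) + 1)) x) k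
  rw [fd_apply hS, if_pos rfl, hx, lp.single_apply_self, ← hx, norm_one] at h2
  rw [hxn, mul_one] at h1
  exact h2.trans h1

lemma fd_riemann_lebesgue {E : Type*} [NormedAddCommGroup E] [NormedSpace ℂ E]
    (f : AddCircle (2 * Real.pi) → E) :
    Filter.Tendsto (fun k : ℕ => ∫ t, fourier ((k : ℤ) + 1) t • f t ∂haarAddCircle)
      Filter.atTop (nhds 0) := by
  have hpi := Real.pi_pos
  have key := Real.tendsto_integral_exp_smul_cocompact
    ((Set.Ioc 0 (0 + 2 * Real.pi)).indicator (fun x : ℝ => f (x : AddCircle (2 * Real.pi))))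
  have hw : Filter.Tendsto (fun k : ℕ => -(((k : ℝ) + 1) / (2 * Real.pi))) Filter.atTop
      (Filter.cocompact ℝ) := by
    refine Filter.Tendsto.mono_right ?_ (atBot_le_cocompact (α := ℝ))
    refine Filter.tendsto_neg_atTop_atBot.comp ?_
    refine Filter.Tendsto.atTop_div_const (by positivity) ?_
    exact Filter.tendsto_atTop_add_const_right _ _ tendsto_natCast_atTop_atTop
  have h := (key.comp hw).const_smul ((1 / (2 * Real.pi) : ℝ))
  rw [smul_zero] at h
  refine h.congr fun k => ?_
  have := fourierCoeff_eq_intervalIntegral f (-((k : ℤ) + 1)) 0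
  rw [fourierCoeff, neg_neg] at this
  rw [this]
  congr 1
  rw [intervalIntegral.integral_of_le (by linarith), ← integral_indicator measurableSet_Ioc]
  simp only [Function.comp_apply]
  congr 1
  ext x
  by_cases hx : x ∈ Set.Ioc 0 (0 + 2 * Real.pi)
  · rw [Set.indicator_of_mem hx, Set.indicator_of_mem hx, fourier_coe_apply, Circle.smul_def,
      Real.fourierChar_apply]
    congr 2
    push_cast
    field_simp
  · rw [Set.indicator_of_notMem hx, Set.indicator_of_notMem hx, smul_zero]

/-- **An absolutely continuous `V^∞` measure with no Radon–Nikodym derivative.**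
The operator `S(φ) = diag(φ̂(1), φ̂(2), …)` is a well-defined bounded operator
`L¹(𝕋) → B(ℓ²)` of norm one; it maps `φ_k = e^{ikt}` to the rank-one projection onto the `k`-th
basis vector for `k ≥ 1` and to `0` for `k ≤ 0`, and it is not representable as integration
against any Bochner-integrable `B(ℓ²)`-valued function. -/
theorem fourier_diagonal_operator :
    (∃ S : L1Circle →L[ℂ] (ellTwoC →L[ℂ] ellTwoC), IsFourierDiagonal S) ∧
    ∀ S : L1Circle →L[ℂ] (ellTwoC →L[ℂ] ellTwoC), IsFourierDiagonal S →
      ‖S‖ = 1 ∧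
      (∀ (k : ℕ) (x : ellTwoC) (n : ℕ),
        (S (fourierLp 1 ((k : ℤ) + 1)) x) n = if n = k then x k else 0) ∧
      (∀ k : ℤ, k ≤ 0 → S (fourierLp 1 k) = 0) ∧
      ¬∃ f : AddCircle (2 * Real.pi) → (ellTwoC →L[ℂ] ellTwoC),
        Integrable f (haarAddCircle : Measure (AddCircle (2 * Real.pi))) ∧
        ∀ φ : C(AddCircle (2 * Real.pi), ℂ),
          S (ContinuousMap.toLp 1 (haarAddCircle : Measure (AddCircle (2 * Real.pi))) ℂ φ) =
            ∫ t, φ t • f t ∂(haarAddCircle : Measure (AddCircle (2 * Real.pi))) := by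
  refine ⟨fd_exists, fun S hS => ⟨le_antisymm (fd_norm_le hS) ?_, fd_apply hS, ?_, ?_⟩⟩
  · have h1 := S.le_opNorm (fourierLp 1 (((0 : ℕ) : ℤ) + 1))
    have h2 := fd_one_le hS 0
    have h3 := mul_le_mul_of_nonneg_left (fd_norm_fourierLp_le (((0 : ℕ) : ℤ) + 1)) (norm_nonneg S)
    linarith
  · intro k hk
    ext x n
    rw [hS, fd_coeff_fourierLp, if_neg (by omega), zero_mul]
    rfl
  · rintro ⟨f, -, hf⟩
    have h := (fd_riemann_lebesgue f).norm
    rw [norm_zero] at h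
    obtain ⟨k, hk⟩ := (h.eventually (gt_mem_nhds one_pos)).exists
    have e := congrArg norm (hf (fourier ((k : ℤ) + 1)))
    exact absurd (e.trans_lt hk) (not_lt.mpr (fd_one_le hS k))

end
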